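/- Let q > 1 and s₀ ∈ ℂ with q^{2s₀} ≠ 1. Define for n ≥ 1: c(n,0;s₀) = (q^{-n/2}/(1+q^{-1}))·[ (q^{(n+1)s₀} - q^{-(n+1)s₀})/(q^{s₀} - q^{-s₀}) - q^{-1}·(q^{(n-1)s₀} - q^{-(n-1)s₀})/(q^{s₀} - q^{-s₀}) ], c(n,1;s₀) = -(q^{-(n-1)/2}/(1+q^{-1}))·(q^{ns₀} - q^{-ns₀})·(1 - q^{-1-2s₀})/(1 - q^{-2s₀}), and c(n,l;s₀) = -q^{-(n-l)/2}(q^{ns₀} - q^{(2l-2-n)s₀})·(1-q^{-1-2s₀})/(1-q^{-2s₀})·√((q-1)/(q+1)) for 2 ≤ l ≤ n. Then these coefficients satisfy the linear system q^{(n-2k)(1/2 + s₀)} = ∑_{l=0}^n c(n,l;s₀)·a(l, n-k) for all 0 ≤ k ≤ n, where a(l,m) are the coset values defined previously. -/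

import Mathlib

noncomputable section

/-- The values `a(l,n)` of the classical vectors `e_l` on the double cosets `D_n`. -/
def cosetVal (q : ℝ) (l n : ℕ) : ℝ :=
  if l = 0 then 1
  else if l = 1 then (if n = 0 then q ^ (-(1/2 : ℝ)) else -(q ^ ((1/2 : ℝ))))
  else if n + 2 ≤ l then 0
  else if n + 1 = l then q ^ (((l:ℝ) - 2) / 2) * Real.sqrt ((q + 1) / (q - 1))
  else -((q - 1) * q ^ (((l:ℝ) - 2) / 2) * Real.sqrt ((q + 1) / (q - 1)))

/-- The change-of-basis coefficients `c(n,l;s₀)` for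
`a(ϖ^{-n}).e₀^{(s₀)} = ∑_l c(n,l;s₀) e_l^{(s₀)}`. -/
def coeffC (q : ℝ) (s₀ : ℂ) (n l : ℕ) : ℂ :=
  if l = 0 then
    ((q:ℂ) ^ (-(n:ℂ) / 2) / (1 + (q:ℂ)⁻¹)) *
      (((q:ℂ) ^ (((n:ℂ) + 1) * s₀) - (q:ℂ) ^ (-(((n:ℂ) + 1) * s₀))) /
          ((q:ℂ) ^ s₀ - (q:ℂ) ^ (-s₀))
        - (q:ℂ)⁻¹ * (((q:ℂ) ^ (((n:ℂ) - 1) * s₀) - (q:ℂ) ^ (-(((n:ℂ) - 1) * s₀))) /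
          ((q:ℂ) ^ s₀ - (q:ℂ) ^ (-s₀))))
  else if l = 1 then
    -((q:ℂ) ^ (-((n:ℂ) - 1) / 2) / (1 + (q:ℂ)⁻¹)) *
      ((q:ℂ) ^ ((n:ℂ) * s₀) - (q:ℂ) ^ (-((n:ℂ) * s₀))) *
      ((1 - (q:ℂ) ^ (-1 - 2 * s₀)) / (1 - (q:ℂ) ^ (-(2 * s₀))))
  else
    -((q:ℂ) ^ (-((n:ℂ) - (l:ℂ)) / 2)) *
      ((q:ℂ) ^ ((n:ℂ) * s₀) - (q:ℂ) ^ ((2 * (l:ℂ) - 2 - (n:ℂ)) * s₀)) *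
      ((1 - (q:ℂ) ^ (-1 - 2 * s₀)) / (1 - (q:ℂ) ^ (-(2 * s₀)))) *
      (Real.sqrt ((q - 1) / (q + 1)) : ℂ)

/-- The common factor of the coefficients `c(n,l;s₀)` with `l ≥ 1`, written in terms of
`r = q^{1/2}` and `x = q^{s₀}`. -/
def coeffFactor (r x : ℂ) : ℂ := (1 - 1 / (r ^ 2 * x ^ 2)) / (1 - 1 / x ^ 2)

lemma cpow_natCast_sub_mul {q : ℂ} (hq : q ≠ 0) (s : ℂ) (a b : ℕ) :
    q ^ (((a : ℂ) - b) * s) = (q ^ s) ^ a / (q ^ s) ^ b := by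
  rw [sub_mul, Complex.cpow_sub _ _ hq, Complex.cpow_nat_mul, Complex.cpow_nat_mul]

lemma cpow_half_sq {q : ℂ} : (q ^ (1 / 2 : ℂ)) ^ 2 = q := by
  rw [← Complex.cpow_nat_mul]
  norm_num

lemma coeffC_zero {q : ℝ} (hq : (q : ℂ) ≠ 0) (s : ℂ) {r x : ℂ}
    (hr : r = (q : ℂ) ^ (1 / 2 : ℂ)) (hx : x = (q : ℂ) ^ s) (n : ℕ) :
    coeffC q s n 0 = 1 / r ^ n / (1 + 1 / r ^ 2) *
      ((x ^ n * x - 1 / (x ^ n * x)) / (x - 1 / x) -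
        1 / r ^ 2 * ((x ^ n / x - x / x ^ n) / (x - 1 / x))) := by
  have h1 := cpow_natCast_sub_mul hq (1 / 2) 0 n
  have h2 := cpow_natCast_sub_mul hq s (n + 1) 0
  have h3 := cpow_natCast_sub_mul hq s 0 (n + 1)
  have h4 := cpow_natCast_sub_mul hq s n 1
  have h5 := cpow_natCast_sub_mul hq s 1 n
  have h6 := cpow_natCast_sub_mul hq s 0 1
  have hr2 : r ^ 2 = q := by rw [hr, cpow_half_sq]
  rw [← hr] at h1
  rw [← hx] at h2 h3 h4 h5 h6
  rw [coeffC, if_pos rfl, hr2,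
    show -(n : ℂ) / 2 = ((0 : ℕ) - (n : ℂ)) * (1 / 2) by push_cast; ring,
    show ((n : ℂ) + 1) * s = ((n + 1 : ℕ) - (0 : ℕ)) * s by push_cast; ring,
    show -(((n + 1 : ℕ) - (0 : ℕ)) * s) = ((0 : ℕ) - ((n + 1 : ℕ) : ℂ)) * s by push_cast; ring,
    show ((n : ℂ) - 1) * s = (n - (1 : ℕ)) * s by push_cast; ring,
    show -(((n : ℂ) - (1 : ℕ)) * s) = ((1 : ℕ) - (n : ℂ)) * s by push_cast; ring,
    show -s = ((0 : ℕ) - ((1 : ℕ) : ℂ)) * s by push_cast; ring, h1, h2, h3, h4, h5, h6, ← hx]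
  simp only [pow_succ, pow_zero, one_mul, div_one, inv_eq_one_div]

lemma coeffFactor_eq {q : ℝ} (hq : (q : ℂ) ≠ 0) (s : ℂ) {r x : ℂ}
    (hr : r = (q : ℂ) ^ (1 / 2 : ℂ)) (hx : x = (q : ℂ) ^ s) :
    (1 - (q : ℂ) ^ (-1 - 2 * s)) / (1 - (q : ℂ) ^ (-(2 * s))) = coeffFactor r x := by
  have hr2 : r ^ 2 = q := by rw [hr, cpow_half_sq]
  have h := cpow_natCast_sub_mul hq s 0 2
  rw [← hx] at h
  rw [coeffFactor, hr2,
    show -1 - 2 * s = -1 + ((0 : ℕ) - ((2 : ℕ) : ℂ)) * s by push_cast; ring,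
    show -(2 * s) = ((0 : ℕ) - ((2 : ℕ) : ℂ)) * s by push_cast; ring,
    Complex.cpow_add _ _ hq, h, Complex.cpow_neg_one]
  simp only [pow_zero, inv_eq_one_div, div_mul_div_comm, one_mul]

lemma coeffC_one {q : ℝ} (hq : (q : ℂ) ≠ 0) (s : ℂ) {r x : ℂ}
    (hr : r = (q : ℂ) ^ (1 / 2 : ℂ)) (hx : x = (q : ℂ) ^ s) (n : ℕ) :
    coeffC q s n 1 =
      -(r / r ^ n / (1 + 1 / r ^ 2)) * (x ^ n - 1 / x ^ n) * coeffFactor r x := by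
  have h1 := cpow_natCast_sub_mul hq (1 / 2) 1 n
  have h2 := cpow_natCast_sub_mul hq s n 0
  have h3 := cpow_natCast_sub_mul hq s 0 n
  have hr2 : r ^ 2 = q := by rw [hr, cpow_half_sq]
  rw [← hr] at h1
  rw [← hx] at h2 h3
  rw [coeffC, if_neg one_ne_zero, if_pos rfl, coeffFactor_eq hq s hr hx, hr2,
    show -((n : ℂ) - 1) / 2 = ((1 : ℕ) - (n : ℂ)) * (1 / 2) by push_cast; ring,
    show -((n : ℂ) * s) = ((0 : ℕ) - (n : ℂ)) * s by push_cast; ring,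
    show (n : ℂ) * s = (n - (0 : ℕ)) * s by push_cast; ring, h1, h2, h3]
  simp only [pow_one, pow_zero, div_one, inv_eq_one_div]

lemma coeffC_add_two {q : ℝ} (hq : (q : ℂ) ≠ 0) (s : ℂ) {r x : ℂ}
    (hr : r = (q : ℂ) ^ (1 / 2 : ℂ)) (hx : x = (q : ℂ) ^ s) (n l : ℕ) :
    coeffC q s n (l + 2) =
      -(r ^ (l + 2) / r ^ n) * (x ^ n - x ^ (2 * l + 2) / x ^ n) * coeffFactor r x *
        (Real.sqrt ((q - 1) / (q + 1)) : ℂ) := by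
  have h1 := cpow_natCast_sub_mul hq (1 / 2) (l + 2) n
  have h2 := cpow_natCast_sub_mul hq s n 0
  have h3 := cpow_natCast_sub_mul hq s (2 * l + 2) n
  rw [← hr] at h1
  rw [← hx] at h2 h3
  rw [coeffC, if_neg (by omega), if_neg (by omega), coeffFactor_eq hq s hr hx,
    show -((n : ℂ) - (l + 2 : ℕ)) / 2 = ((l + 2 : ℕ) - (n : ℂ)) * (1 / 2) by push_cast; ring,
    show (2 * ((l + 2 : ℕ) : ℂ) - 2 - n) * s = ((2 * l + 2 : ℕ) - (n : ℂ)) * s by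
      push_cast; ring,
    show (n : ℂ) * s = (n - (0 : ℕ)) * s by push_cast; ring, h1, h2, h3]
  simp only [pow_zero, div_one]

lemma ofReal_rpow_half {q : ℝ} (hq : 0 ≤ q) (l : ℕ) :
    ((q ^ ((l : ℝ) / 2) : ℝ) : ℂ) = ((q : ℂ) ^ (1 / 2 : ℂ)) ^ l := by
  rw [Complex.ofReal_cpow hq, ← Complex.cpow_nat_mul]
  push_cast
  congr 1
  ring

lemma sqrt_div_mul_sqrt_div {q : ℝ} (hq : 1 < q) :
    (Real.sqrt ((q - 1) / (q + 1)) : ℂ) * (Real.sqrt ((q + 1) / (q - 1)) : ℂ) = 1 := by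
  have h1 : 0 < q - 1 := by linarith
  have h2 : 0 < q + 1 := by linarith
  rw [← Complex.ofReal_mul, ← Real.sqrt_mul (by positivity),
    show (q - 1) / (q + 1) * ((q + 1) / (q - 1)) = 1 by field_simp]
  simp

lemma cosetVal_of_lt (q : ℝ) {l m : ℕ} (h : m + 2 ≤ l) : cosetVal q l m = 0 := by
  rw [cosetVal, if_neg (by omega), if_neg (by omega), if_pos h]

lemma cosetVal_diag {q : ℝ} (hq : 0 ≤ q) (l : ℕ) :
    (cosetVal q (l + 2) (l + 1) : ℂ) =
      ((q : ℂ) ^ (1 / 2 : ℂ)) ^ l * (Real.sqrt ((q + 1) / (q - 1)) : ℂ) := by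
  rw [cosetVal, if_neg (by omega), if_neg (by omega), if_neg (by omega), if_pos rfl,
    show (((l + 2 : ℕ) : ℝ) - 2) / 2 = (l : ℝ) / 2 by push_cast; ring,
    Complex.ofReal_mul, ofReal_rpow_half hq]

lemma cosetVal_of_le {q : ℝ} (hq : 0 ≤ q) {l m : ℕ} (h : l + 2 ≤ m) :
    (cosetVal q (l + 2) m : ℂ) =
      -((q - 1) * ((q : ℂ) ^ (1 / 2 : ℂ)) ^ l * (Real.sqrt ((q + 1) / (q - 1)) : ℂ)) := by
  rw [cosetVal, if_neg (by omega), if_neg (by omega), if_neg (by omega), if_neg (by omega),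
    show (((l + 2 : ℕ) : ℝ) - 2) / 2 = (l : ℝ) / 2 by push_cast; ring,
    Complex.ofReal_neg, Complex.ofReal_mul, Complex.ofReal_mul, ofReal_rpow_half hq]
  push_cast
  rfl

lemma coeffC_mul_cosetVal_diag {q : ℝ} (hq : 1 < q) (s : ℂ) {r x : ℂ}
    (hr : r = (q : ℂ) ^ (1 / 2 : ℂ)) (hx : x = (q : ℂ) ^ s) (n l : ℕ) :
    coeffC q s n (l + 2) * (cosetVal q (l + 2) (l + 1) : ℂ) =
      -(r ^ (2 * l + 2) / r ^ n) * (x ^ n - x ^ (2 * l + 2) / x ^ n) * coeffFactor r x := by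
  have hq0 : (q : ℂ) ≠ 0 := by exact_mod_cast (by linarith : q ≠ 0)
  rw [coeffC_add_two hq0 s hr hx, cosetVal_diag (by linarith), ← hr]
  linear_combination (-(r ^ (2 * l + 2) / r ^ n) * (x ^ n - x ^ (2 * l + 2) / x ^ n) *
    coeffFactor r x) * sqrt_div_mul_sqrt_div hq

lemma coeffC_mul_cosetVal_of_le {q : ℝ} (hq : 1 < q) (s : ℂ) {r x : ℂ}
    (hr : r = (q : ℂ) ^ (1 / 2 : ℂ)) (hx : x = (q : ℂ) ^ s) (n : ℕ) {l m : ℕ}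
    (h : l + 2 ≤ m) :
    coeffC q s n (l + 2) * (cosetVal q (l + 2) m : ℂ) =
      (r ^ 2 - 1) * (r ^ (2 * l + 2) / r ^ n) * (x ^ n - x ^ (2 * l + 2) / x ^ n) *
        coeffFactor r x := by
  have hq0 : (q : ℂ) ≠ 0 := by exact_mod_cast (by linarith : q ≠ 0)
  have hr2 : r ^ 2 = q := by rw [hr, cpow_half_sq]
  rw [coeffC_add_two hq0 s hr hx, cosetVal_of_le (by linarith) h, ← hr, ← hr2]
  linear_combination ((r ^ 2 - 1) * (r ^ (2 * l + 2) / r ^ n) *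
    (x ^ n - x ^ (2 * l + 2) / x ^ n) * coeffFactor r x) * sqrt_div_mul_sqrt_div hq

/-- The terms with `l ≥ m + 2` vanish, and so does `c(n,n+1;s₀)`. -/
lemma sum_range_eq_sum_range_add_two {q : ℝ} (hq : 1 < q) (s : ℂ) {n m : ℕ} (hn : 1 ≤ n)
    (hm : m ≤ n) :
    ∑ l ∈ Finset.range (n + 1), coeffC q s n l * (cosetVal q l m : ℂ) =
      ∑ l ∈ Finset.range (m + 2), coeffC q s n l * (cosetVal q l m : ℂ) := by
  have hq0 : (q : ℂ) ≠ 0 := by exact_mod_cast (by linarith : q ≠ 0)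
  rcases hm.eq_or_lt with rfl | hlt
  · obtain ⟨j, rfl⟩ := Nat.exists_eq_add_of_le' hn
    rw [Finset.sum_range_succ _ (j + 1 + 1), coeffC_mul_cosetVal_diag hq s rfl rfl]
    have hx : (q : ℂ) ^ s ≠ 0 := by simp [Complex.cpow_eq_zero_iff, hq0]
    have h : ((q : ℂ) ^ s) ^ (j + 1) -
        ((q : ℂ) ^ s) ^ (2 * j + 2) / ((q : ℂ) ^ s) ^ (j + 1) = 0 := by
      field_simp
      ring
    rw [h]
    simp
  · symm
    apply Finset.sum_subset (Finset.range_subset_range.2 (by omega))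
    intro l _ hl
    rw [Finset.mem_range, not_lt] at hl
    simp [cosetVal_of_lt q hl]

lemma coeffFactor_mul {r x : ℂ} (hr : r ≠ 0) (hx : x ≠ 0) (hx2 : x ^ 2 ≠ 1) :
    coeffFactor r x * (r ^ 2 * (x ^ 2 - 1)) = r ^ 2 * x ^ 2 - 1 := by
  have : x ^ 2 - 1 ≠ 0 := sub_ne_zero.2 hx2
  rw [coeffFactor]
  field_simp

/-- Partial sums of the terms `2 ≤ l ≤ m` of the linear system. -/
lemma sum_coeffFactor {r x : ℂ} (hr : r ≠ 0) (hx : x ≠ 0) (hx2 : x ^ 2 ≠ 1) (A X : ℂ) (j : ℕ) :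
    ∑ i ∈ Finset.range j, (r ^ 2 - 1) * (r ^ (2 * i + 2) / A) * (X - x ^ (2 * i + 2) / X) *
        coeffFactor r x =
      r ^ (2 * j + 2) / A * (x ^ (2 * j + 2) / X) - r ^ 2 / A * (x ^ 2 / X)
        + r ^ (2 * j + 2) / A * (X - x ^ (2 * j + 2) / X) * coeffFactor r x
        - r ^ 2 / A * (X - x ^ 2 / X) * coeffFactor r x := by
  induction j with
  | zero => simp
  | succ j ih =>
    rw [Finset.sum_range_succ, ih]
    linear_combination (r ^ (2 * j + 2) / A * (x ^ (2 * j + 2) / X)) *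
      coeffFactor_mul hr hx hx2

lemma linear_system_zero {r x : ℂ} (hr : r ≠ 0) (hx : x ≠ 0) (hx2 : x ^ 2 ≠ 1)
    (hr2 : r ^ 2 + 1 ≠ 0) {A X : ℂ} (hA : A ≠ 0) (hX : X ≠ 0) :
    1 / A / (1 + 1 / r ^ 2) * ((X * x - 1 / (X * x)) / (x - 1 / x) -
        1 / r ^ 2 * ((X / x - x / X) / (x - 1 / x))) +
      -(r / A / (1 + 1 / r ^ 2)) * (X - 1 / X) * coeffFactor r x * (1 / r) =
    1 / A * (1 / X) := by
  have h : x ^ 2 - 1 ≠ 0 := sub_ne_zero.2 hx2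
  rw [coeffFactor]
  field_simp
  ring

lemma linear_system_one {r x : ℂ} (hr : r ≠ 0) (hx : x ≠ 0) (hx2 : x ^ 2 ≠ 1)
    (hr2 : r ^ 2 + 1 ≠ 0) {A X : ℂ} (hA : A ≠ 0) (hX : X ≠ 0) :
    1 / A / (1 + 1 / r ^ 2) * ((X * x - 1 / (X * x)) / (x - 1 / x) -
        1 / r ^ 2 * ((X / x - x / X) / (x - 1 / x))) +
      -(r / A / (1 + 1 / r ^ 2)) * (X - 1 / X) * coeffFactor r x * (-r) =
    r ^ 2 / A * (x ^ 2 / X) + r ^ 2 / A * (X - x ^ 2 / X) * coeffFactor r x := by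
  have h : x ^ 2 - 1 ≠ 0 := sub_ne_zero.2 hx2
  rw [coeffFactor]
  field_simp
  ring

/-- the coefficients `c(n,l;s₀)` solve the linear system
`q^{(n-2k)(1/2+s₀)} = ∑_{l=0}^n c(n,l;s₀) a(l,n-k)` for `0 ≤ k ≤ n`. -/
theorem coeffC_linear_system (q : ℝ) (hq : 1 < q) (s₀ : ℂ)
    (hs₀ : (q:ℂ) ^ (2 * s₀) ≠ 1) :
    ∀ n : ℕ, 1 ≤ n → ∀ k : ℕ, k ≤ n →
      (q:ℂ) ^ (((n:ℂ) - 2 * (k:ℂ)) * (1/2 + s₀))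
        = ∑ l ∈ Finset.range (n + 1), coeffC q s₀ n l * (cosetVal q l (n - k) : ℂ) := by
  intro n hn k hk
  obtain ⟨m, rfl⟩ := Nat.exists_eq_add_of_le' hk
  have hq0 : (q : ℂ) ≠ 0 := by exact_mod_cast (by linarith : q ≠ 0)
  obtain ⟨r, hr⟩ : ∃ r, r = (q : ℂ) ^ (1 / 2 : ℂ) := ⟨_, rfl⟩
  obtain ⟨x, hx⟩ : ∃ x, x = (q : ℂ) ^ s₀ := ⟨_, rfl⟩
  have hr0 : r ≠ 0 := by simp [hr, Complex.cpow_eq_zero_iff, hq0]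
  have hx0 : x ≠ 0 := by simp [hx, Complex.cpow_eq_zero_iff, hq0]
  have hx2 : x ^ 2 ≠ 1 := by
    rw [hx, ← Complex.cpow_nat_mul]
    exact_mod_cast hs₀
  have hr2 : r ^ 2 + 1 ≠ 0 := by
    rw [hr, cpow_half_sq]
    exact_mod_cast (by linarith : q + 1 ≠ 0)
  have hhalf : ((q ^ (1 / 2 : ℝ) : ℝ) : ℂ) = r := by
    simpa [hr] using ofReal_rpow_half (by linarith : 0 ≤ q) 1
  have hA : r ^ (m + k) ≠ 0 := pow_ne_zero _ hr0
  have hX : x ^ (m + k) ≠ 0 := pow_ne_zero _ hx0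
  have hlhs : (q : ℂ) ^ ((((m + k : ℕ) : ℂ) - 2 * (k : ℂ)) * (1 / 2 + s₀)) =
      r ^ (2 * m) / r ^ (m + k) * (x ^ (2 * m) / x ^ (m + k)) := by
    rw [hr, hx, ← cpow_natCast_sub_mul hq0, ← cpow_natCast_sub_mul hq0,
      ← Complex.cpow_add _ _ hq0]
    congr 1
    push_cast
    ring
  rw [hlhs, Nat.add_sub_cancel, sum_range_eq_sum_range_add_two hq s₀ hn (by omega)]
  have h0 (m : ℕ) : (cosetVal q 0 m : ℂ) = 1 := by simp [cosetVal]
  rcases m with _ | j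
  · have h1 : (cosetVal q 1 0 : ℂ) = 1 / r := by
      rw [cosetVal, if_neg one_ne_zero, if_pos rfl, if_pos rfl, Real.rpow_neg (by linarith),
        Complex.ofReal_inv, hhalf, one_div]
    rw [Finset.sum_range_succ, Finset.sum_range_one, h0, h1, coeffC_zero hq0 s₀ hr hx,
      coeffC_one hq0 s₀ hr hx, mul_one, linear_system_zero hr0 hx0 hx2 hr2 hA hX]
    simp
  · have h1 : (cosetVal q 1 (j + 1) : ℂ) = -r := by
      rw [cosetVal, if_neg one_ne_zero, if_pos rfl, if_neg (by omega), Complex.ofReal_neg, hhalf]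
    rw [Finset.sum_range_succ, Finset.sum_range_succ', Finset.sum_range_succ', zero_add,
      coeffC_mul_cosetVal_diag hq s₀ hr hx,
      Finset.sum_congr rfl fun i hi => coeffC_mul_cosetVal_of_le hq s₀ hr hx _
        (by rw [Finset.mem_range] at hi; omega : i + 2 ≤ j + 1),
      sum_coeffFactor hr0 hx0 hx2, h0, h1, coeffC_zero hq0 s₀ hr hx, coeffC_one hq0 s₀ hr hx]
    linear_combination -linear_system_one hr0 hx0 hx2 hr2 hA hX
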